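/- arXiv:2010.06701 — 5 statements merged into one kernel-verified Lean document; each statement's English description precedes it below -/
import Mathlib

section
/- Pressure Poisson equation (homogeneous case): suppose v : ℝ → ℝ^{nv} is differentiable, p : ℝ → ℝ^{np}, and for all t the DAE holds: E v̇(t) = A11 v(t) + A12 p(t) + H (v(t) ⊗ v(t)) + f(t) and A12ᵀ v(t) = 0. Then for all t, p(t) = -S⁻¹ A12ᵀ E⁻¹ (A11 v(t) + H (v(t) ⊗ v(t)) + f(t)). -/
open Matrix

/-- A fixed matrix commutes with differentiation of a vector-valued curve. -/
theorem hasDerivAt_mulVec {m n : Type*} [Fintype m] [Fintype n] (M : Matrix m n ℝ)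
    {v : ℝ → n → ℝ} {v' : n → ℝ} {t : ℝ} (hv : HasDerivAt v v' t) :
    HasDerivAt (fun s => M.mulVec (v s)) (M.mulVec v') t :=
  (LinearMap.toContinuousLinearMap M.mulVecLin).hasFDerivAt.comp_hasDerivAt t hv

/-- Pressure Poisson equation (homogeneous case): if the velocity–pressure pair
solves the semi-discrete Navier–Stokes DAE with homogeneous constraint
`A12ᵀ v(t) = 0`, then the pressure satisfies
`p(t) = -S⁻¹ A12ᵀ E⁻¹ (A11 v(t) + H (v(t) ⊗ v(t)) + f(t))`. -/
theorem pressure_poisson_homogeneous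
    (nv np : ℕ) (hnv : 0 < nv) (hnp : 0 < np)
    (E A11 : Matrix (Fin nv) (Fin nv) ℝ) (A12 : Matrix (Fin nv) (Fin np) ℝ)
    (H : Matrix (Fin nv) (Fin nv × Fin nv) ℝ)
    (hE : IsUnit E) (hS : IsUnit (A12ᵀ * E⁻¹ * A12))
    (v : ℝ → Fin nv → ℝ) (p : ℝ → Fin np → ℝ) (f : ℝ → Fin nv → ℝ)
    (hv : Differentiable ℝ v)
    (hdae : ∀ t : ℝ, E.mulVec (deriv v t) =
        A11.mulVec (v t) + A12.mulVec (p t)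
          + H.mulVec (fun q => v t q.1 * v t q.2) + f t)
    (hcon : ∀ t : ℝ, A12ᵀ.mulVec (v t) = 0) :
    ∀ t : ℝ, p t =
      -((A12ᵀ * E⁻¹ * A12)⁻¹ * A12ᵀ * E⁻¹).mulVec
          (A11.mulVec (v t) + H.mulVec (fun q => v t q.1 * v t q.2) + f t) := by
  intro t
  have hE' : IsUnit E.det := (isUnit_iff_isUnit_det E).mp hE
  have hS' : IsUnit (A12ᵀ * E⁻¹ * A12).det := (isUnit_iff_isUnit_det _).mp hS
  have hder : A12ᵀ.mulVec (deriv v t) = 0 := by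
    have h := hasDerivAt_mulVec A12ᵀ (hv t).hasDerivAt
    simp only [hcon] at h
    exact h.unique (hasDerivAt_const t 0)
  set g := A11.mulVec (v t) + H.mulVec (fun q => v t q.1 * v t q.2) + f t with hg
  have hd : E.mulVec (deriv v t) = A12.mulVec (p t) + g := by
    rw [hdae t, hg]; abel
  have hSp : (A12ᵀ * E⁻¹ * A12).mulVec (p t) + (A12ᵀ * E⁻¹).mulVec g = 0 := by
    rw [← mulVec_mulVec, ← mulVec_add, ← hd, mulVec_mulVec, Matrix.mul_assoc,
      nonsing_inv_mul E hE', Matrix.mul_one, hder]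
  calc p t = (A12ᵀ * E⁻¹ * A12)⁻¹.mulVec ((A12ᵀ * E⁻¹ * A12).mulVec (p t)) := by
        rw [mulVec_mulVec, nonsing_inv_mul _ hS', one_mulVec]
    _ = _ := by
        rw [eq_neg_of_add_eq_zero_left hSp, mulVec_neg, mulVec_mulVec, ← Matrix.mul_assoc]
end

section
/- Underlying velocity ODE (homogeneous case): suppose v : ℝ → ℝ^{nv} is differentiable, p : ℝ → ℝ^{np}, and for all t the DAE holds: E v̇(t) = A11 v(t) + A12 p(t) + H (v(t) ⊗ v(t)) + f(t) and A12ᵀ v(t) = 0. Then for all t, E v̇(t) = Πᵀ A11 v(t) + Πᵀ H (v(t) ⊗ v(t)) + Πᵀ f(t), where Πᵀ = I - A12 S⁻¹ A12ᵀ E⁻¹. -/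
open Matrix

/-- A linear constraint satisfied along a differentiable curve is satisfied by its derivative. -/
theorem mulVec_deriv_eq_zero {m n : Type*} [Fintype m] [Fintype n]
    (B : Matrix m n ℝ) {v : ℝ → n → ℝ} {t : ℝ} (hv : DifferentiableAt ℝ v t)
    (hB : ∀ s, B *ᵥ v s = 0) : B *ᵥ deriv v t = 0 := by
  have h : HasDerivAt (fun s => B *ᵥ v s) (B *ᵥ deriv v t) t :=
    (LinearMap.toContinuousLinearMap B.mulVecLin).hasFDerivAt.comp_hasDerivAt t hv.hasDerivAt
  simp only [hB] at h
  exact h.unique (hasDerivAt_const t 0)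

/-- The transposed discrete Leray projector annihilates the range of `A`. -/
theorem one_sub_mul_eq_zero {m n : Type*} [Fintype m] [Fintype n] [DecidableEq m] [DecidableEq n]
    {A : Matrix m n ℝ} {F : Matrix m m ℝ} (hS : IsUnit (Aᵀ * F * A)) :
    (1 - A * (Aᵀ * F * A)⁻¹ * Aᵀ * F) * A = 0 := by
  have h : A * (Aᵀ * F * A)⁻¹ * Aᵀ * F * A = A * ((Aᵀ * F * A)⁻¹ * (Aᵀ * F * A)) := by
    simp only [Matrix.mul_assoc]
  rw [Matrix.sub_mul, Matrix.one_mul, h,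
    Matrix.nonsing_inv_mul _ ((Matrix.isUnit_iff_isUnit_det _).1 hS), Matrix.mul_one, sub_self]

/-- Underlying velocity ODE (homogeneous case): if the velocity–pressure pair
solves the semi-discrete Navier–Stokes DAE with homogeneous constraint
`A12ᵀ v(t) = 0`, then the velocity solves the projected ODE
`E v̇(t) = Πᵀ A11 v(t) + Πᵀ H (v(t) ⊗ v(t)) + Πᵀ f(t)` with
`Πᵀ = I - A12 S⁻¹ A12ᵀ E⁻¹`. -/
theorem underlying_velocity_ode_homogeneous
    (nv np : ℕ) (hnv : 0 < nv) (hnp : 0 < np)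
    (E A11 : Matrix (Fin nv) (Fin nv) ℝ) (A12 : Matrix (Fin nv) (Fin np) ℝ)
    (H : Matrix (Fin nv) (Fin nv × Fin nv) ℝ)
    (hE : IsUnit E) (hS : IsUnit (A12ᵀ * E⁻¹ * A12))
    (v : ℝ → Fin nv → ℝ) (p : ℝ → Fin np → ℝ) (f : ℝ → Fin nv → ℝ)
    (hv : Differentiable ℝ v)
    (hdae : ∀ t : ℝ, E.mulVec (deriv v t) =
        A11.mulVec (v t) + A12.mulVec (p t)
          + H.mulVec (fun q => v t q.1 * v t q.2) + f t)
    (hcon : ∀ t : ℝ, A12ᵀ.mulVec (v t) = 0) :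
    ∀ t : ℝ, E.mulVec (deriv v t) =
      (((1 : Matrix (Fin nv) (Fin nv) ℝ)
          - A12 * (A12ᵀ * E⁻¹ * A12)⁻¹ * A12ᵀ * E⁻¹) * A11).mulVec (v t)
      + (((1 : Matrix (Fin nv) (Fin nv) ℝ)
          - A12 * (A12ᵀ * E⁻¹ * A12)⁻¹ * A12ᵀ * E⁻¹) * H).mulVec
            (fun q => v t q.1 * v t q.2)
      + ((1 : Matrix (Fin nv) (Fin nv) ℝ)
          - A12 * (A12ᵀ * E⁻¹ * A12)⁻¹ * A12ᵀ * E⁻¹).mulVec (f t) := by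
  intro t
  have hd : A12ᵀ *ᵥ deriv v t = 0 := mulVec_deriv_eq_zero _ (hv t) hcon
  have hA := one_sub_mul_eq_zero hS
  have hfix : (1 - A12 * (A12ᵀ * E⁻¹ * A12)⁻¹ * A12ᵀ * E⁻¹) *ᵥ (E *ᵥ deriv v t)
      = E *ᵥ deriv v t := by
    rw [sub_mulVec, one_mulVec, mulVec_mulVec, Matrix.mul_assoc _ E⁻¹ E,
      Matrix.nonsing_inv_mul _ ((Matrix.isUnit_iff_isUnit_det _).1 hE), Matrix.mul_one,
      ← mulVec_mulVec, hd, mulVec_zero, sub_zero]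
  rw [← hfix, hdae t]
  simp only [mulVec_add, mulVec_mulVec, hA, zero_mulVec, add_zero]
end

section
/- Pressure Poisson equation (inhomogeneous case): suppose v : ℝ → ℝ^{nv} and u⊥ : ℝ → ℝ^{m} are differentiable, p : ℝ → ℝ^{np}, B⊥ is a real np×m matrix, and for all t: E v̇(t) = A11 v(t) + A12 p(t) + H (v(t) ⊗ v(t)) + f(t) and A12ᵀ v(t) + B⊥ u⊥(t) = 0. Then for all t, p(t) = -S⁻¹ A12ᵀ E⁻¹ (A11 v(t) + H (v(t) ⊗ v(t)) + f(t)) - S⁻¹ B⊥ u̇⊥(t). -/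
open Matrix

/-- A constant matrix commutes with differentiation of a vector-valued curve. -/
theorem HasDerivAt.matrix_mulVec {k l : Type*} [Fintype k] [Fintype l] (M : Matrix k l ℝ)
    {x : ℝ → l → ℝ} {x' : l → ℝ} {t : ℝ} (hx : HasDerivAt x x' t) :
    HasDerivAt (fun s => M *ᵥ x s) (M *ᵥ x') t :=
  (LinearMap.toContinuousLinearMap M.mulVecLin).hasFDerivAt.comp_hasDerivAt t hx

/-- Pressure Poisson equation (inhomogeneous case): if the velocity–pressure pair
solves the semi-discrete Navier–Stokes DAE with inhomogeneous constraint
`A12ᵀ v(t) + B⊥ u⊥(t) = 0`, then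
`p(t) = -S⁻¹ A12ᵀ E⁻¹ (A11 v(t) + H (v(t) ⊗ v(t)) + f(t)) - S⁻¹ B⊥ u̇⊥(t)`. -/
theorem pressure_poisson_inhomogeneous
    (nv np m : ℕ) (hnv : 0 < nv) (hnp : 0 < np) (hm : 0 < m)
    (E A11 : Matrix (Fin nv) (Fin nv) ℝ) (A12 : Matrix (Fin nv) (Fin np) ℝ)
    (H : Matrix (Fin nv) (Fin nv × Fin nv) ℝ)
    (Bperp : Matrix (Fin np) (Fin m) ℝ)
    (hE : IsUnit E) (hS : IsUnit (A12ᵀ * E⁻¹ * A12))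
    (v : ℝ → Fin nv → ℝ) (uperp : ℝ → Fin m → ℝ)
    (p : ℝ → Fin np → ℝ) (f : ℝ → Fin nv → ℝ)
    (hv : Differentiable ℝ v) (hu : Differentiable ℝ uperp)
    (hdae : ∀ t : ℝ, E.mulVec (deriv v t) =
        A11.mulVec (v t) + A12.mulVec (p t)
          + H.mulVec (fun q => v t q.1 * v t q.2) + f t)
    (hcon : ∀ t : ℝ, A12ᵀ.mulVec (v t) + Bperp.mulVec (uperp t) = 0) :
    ∀ t : ℝ, p t =
      -((A12ᵀ * E⁻¹ * A12)⁻¹ * A12ᵀ * E⁻¹).mulVec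
          (A11.mulVec (v t) + H.mulVec (fun q => v t q.1 * v t q.2) + f t)
      - ((A12ᵀ * E⁻¹ * A12)⁻¹ * Bperp).mulVec (deriv uperp t) := by
  intro t
  have hdcon : A12ᵀ *ᵥ deriv v t + Bperp *ᵥ deriv uperp t = 0 := by
    have h := ((hv t).hasDerivAt.matrix_mulVec A12ᵀ).add
      ((hu t).hasDerivAt.matrix_mulVec Bperp)
    have h0 : ((fun s => A12ᵀ *ᵥ v s) + fun s => Bperp *ᵥ uperp s) = fun _ => 0 := funext hcon
    rw [h0] at h
    exact h.unique (hasDerivAt_const t 0)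
  set g := A11 *ᵥ v t + H *ᵥ (fun q => v t q.1 * v t q.2) + f t with hg
  have hdv : deriv v t = E⁻¹ *ᵥ (g + A12 *ᵥ p t) := by
    have h : g + A12 *ᵥ p t = E *ᵥ deriv v t := by
      rw [hdae t, hg]
      abel
    rw [h, mulVec_mulVec, nonsing_inv_mul E ((isUnit_iff_isUnit_det E).mp hE), one_mulVec]
  set S := A12ᵀ * E⁻¹ * A12 with hSdef
  have hSp : S *ᵥ p t = -(A12ᵀ *ᵥ E⁻¹ *ᵥ g) - Bperp *ᵥ deriv uperp t := by
    rw [hdv, mulVec_add, mulVec_add] at hdcon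
    rw [hSdef, ← mulVec_mulVec, ← mulVec_mulVec]
    linear_combination hdcon
  have hp : p t = S⁻¹ *ᵥ S *ᵥ p t := by
    rw [mulVec_mulVec, nonsing_inv_mul S ((isUnit_iff_isUnit_det S).mp hS), one_mulVec]
  rw [hp, hSp, mulVec_sub, mulVec_neg]
  simp only [mulVec_mulVec, Matrix.mul_assoc]
end

section
/- Underlying velocity ODE (inhomogeneous case): suppose v : ℝ → ℝ^{nv} and u⊥ : ℝ → ℝ^{m} are differentiable, p : ℝ → ℝ^{np}, B⊥ is a real np×m matrix, and for all t: E v̇(t) = A11 v(t) + A12 p(t) + H (v(t) ⊗ v(t)) + f(t) and A12ᵀ v(t) + B⊥ u⊥(t) = 0. Then for all t, E v̇(t) = Πᵀ A11 v(t) + Πᵀ H (v(t) ⊗ v(t)) + Πᵀ f(t) - A12 S⁻¹ B⊥ u̇⊥(t), where Πᵀ = I - A12 S⁻¹ A12ᵀ E⁻¹. -/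
open Matrix

theorem Matrix.hasDerivAt_mulVec {k l : ℕ} (M : Matrix (Fin k) (Fin l) ℝ)
    {x : ℝ → Fin l → ℝ} {x' : Fin l → ℝ} {t : ℝ} (hx : HasDerivAt x x' t) :
    HasDerivAt (fun s => M.mulVec (x s)) (M.mulVec x') t :=
  (LinearMap.toContinuousLinearMap M.mulVecLin).hasFDerivAt.comp_hasDerivAt t hx

theorem Matrix.one_sub_schur_mul_self {k l : ℕ} (F : Matrix (Fin k) (Fin k) ℝ)
    (A : Matrix (Fin k) (Fin l) ℝ) (hS : IsUnit (Aᵀ * F * A)) :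
    (1 - A * (Aᵀ * F * A)⁻¹ * Aᵀ * F) * A = 0 := by
  have h := Matrix.nonsing_inv_mul _ ((Matrix.isUnit_iff_isUnit_det _).1 hS)
  rw [Matrix.sub_mul, Matrix.one_mul, sub_eq_zero]
  calc A = A * ((Aᵀ * F * A)⁻¹ * (Aᵀ * F * A)) := by rw [h, Matrix.mul_one]
    _ = A * (Aᵀ * F * A)⁻¹ * Aᵀ * F * A := by simp only [Matrix.mul_assoc]

/-- Underlying velocity ODE (inhomogeneous case): if the velocity–pressure pair
solves the semi-discrete Navier–Stokes DAE with inhomogeneous constraint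
`A12ᵀ v(t) + B⊥ u⊥(t) = 0`, then
`E v̇(t) = Πᵀ A11 v(t) + Πᵀ H (v(t) ⊗ v(t)) + Πᵀ f(t) - A12 S⁻¹ B⊥ u̇⊥(t)`
with `Πᵀ = I - A12 S⁻¹ A12ᵀ E⁻¹`. -/
theorem underlying_velocity_ode_inhomogeneous
    (nv np m : ℕ) (hnv : 0 < nv) (hnp : 0 < np) (hm : 0 < m)
    (E A11 : Matrix (Fin nv) (Fin nv) ℝ) (A12 : Matrix (Fin nv) (Fin np) ℝ)
    (H : Matrix (Fin nv) (Fin nv × Fin nv) ℝ)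
    (Bperp : Matrix (Fin np) (Fin m) ℝ)
    (hE : IsUnit E) (hS : IsUnit (A12ᵀ * E⁻¹ * A12))
    (v : ℝ → Fin nv → ℝ) (uperp : ℝ → Fin m → ℝ)
    (p : ℝ → Fin np → ℝ) (f : ℝ → Fin nv → ℝ)
    (hv : Differentiable ℝ v) (hu : Differentiable ℝ uperp)
    (hdae : ∀ t : ℝ, E.mulVec (deriv v t) =
        A11.mulVec (v t) + A12.mulVec (p t)
          + H.mulVec (fun q => v t q.1 * v t q.2) + f t)
    (hcon : ∀ t : ℝ, A12ᵀ.mulVec (v t) + Bperp.mulVec (uperp t) = 0) :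
    ∀ t : ℝ, E.mulVec (deriv v t) =
      (((1 : Matrix (Fin nv) (Fin nv) ℝ)
          - A12 * (A12ᵀ * E⁻¹ * A12)⁻¹ * A12ᵀ * E⁻¹) * A11).mulVec (v t)
      + (((1 : Matrix (Fin nv) (Fin nv) ℝ)
          - A12 * (A12ᵀ * E⁻¹ * A12)⁻¹ * A12ᵀ * E⁻¹) * H).mulVec
            (fun q => v t q.1 * v t q.2)
      + ((1 : Matrix (Fin nv) (Fin nv) ℝ)
          - A12 * (A12ᵀ * E⁻¹ * A12)⁻¹ * A12ᵀ * E⁻¹).mulVec (f t)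
      - (A12 * (A12ᵀ * E⁻¹ * A12)⁻¹ * Bperp).mulVec (deriv uperp t) := by
  intro t
  have hder : A12ᵀ.mulVec (deriv v t) + Bperp.mulVec (deriv uperp t) = 0 := by
    have h := (Matrix.hasDerivAt_mulVec A12ᵀ (hv t).hasDerivAt).add
      (Matrix.hasDerivAt_mulVec Bperp (hu t).hasDerivAt)
    have h0 : ((fun s => A12ᵀ.mulVec (v s)) + fun s => Bperp.mulVec (uperp s)) =
        fun _ => 0 := funext hcon
    rw [h0] at h
    exact h.unique (hasDerivAt_const t _)
  have hPA := Matrix.one_sub_schur_mul_self E⁻¹ A12 hS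
  have hEE := Matrix.nonsing_inv_mul E ((Matrix.isUnit_iff_isUnit_det E).1 hE)
  set S := A12ᵀ * E⁻¹ * A12
  have hPE : (1 - A12 * S⁻¹ * A12ᵀ * E⁻¹).mulVec (E.mulVec (deriv v t)) =
      E.mulVec (deriv v t) + (A12 * S⁻¹ * Bperp).mulVec (deriv uperp t) := by
    rw [Matrix.mulVec_mulVec, Matrix.sub_mul, Matrix.one_mul, Matrix.mul_assoc _ E⁻¹ E, hEE,
      Matrix.mul_one, Matrix.sub_mulVec, ← Matrix.mulVec_mulVec _ _ A12ᵀ,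
      eq_neg_of_add_eq_zero_left hder, Matrix.mulVec_neg, Matrix.mulVec_mulVec, sub_neg_eq_add]
  rw [eq_sub_iff_add_eq, ← hPE, hdae t]
  simp only [Matrix.mulVec_add, Matrix.mulVec_mulVec, hPA, Matrix.zero_mulVec, add_zero]
end

section
/- Invariance of the divergence-free constraint under the projected ODE: suppose v : ℝ → ℝ^{nv} is differentiable, w : ℝ → ℝ^{nv} is any function, and for all t it holds that E v̇(t) = Πᵀ w(t), where Πᵀ = I - A12 S⁻¹ A12ᵀ E⁻¹. If A12ᵀ v(0) = 0, then A12ᵀ v(t) = 0 for all t. -/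
open Matrix

/-- The transposed discrete Leray projector maps into the kernel of `Bᵀ E⁻¹`. -/
lemma transpose_mul_inv_mul_lerayProjector {m n R : Type*} [Fintype m] [DecidableEq m]
    [Fintype n] [DecidableEq n] [CommRing R] (E : Matrix m m R) (B : Matrix m n R)
    (hS : IsUnit (Bᵀ * E⁻¹ * B)) :
    Bᵀ * E⁻¹ * (1 - B * (Bᵀ * E⁻¹ * B)⁻¹ * Bᵀ * E⁻¹) = 0 := by
  have h := Matrix.mul_nonsing_inv _ ((Matrix.isUnit_iff_isUnit_det _).1 hS)
  calc Bᵀ * E⁻¹ * (1 - B * (Bᵀ * E⁻¹ * B)⁻¹ * Bᵀ * E⁻¹)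
      = Bᵀ * E⁻¹ - (Bᵀ * E⁻¹ * B) * (Bᵀ * E⁻¹ * B)⁻¹ * (Bᵀ * E⁻¹) := by
        rw [Matrix.mul_sub, Matrix.mul_one]
        simp only [Matrix.mul_assoc]
    _ = 0 := by rw [h, Matrix.one_mul, sub_self]

/-- A differentiable curve whose derivative lies in the kernel of `M` has constant image
under `M`. -/
lemma mulVec_eq_of_mulVec_deriv_eq_zero {m n : Type*} [Fintype m] [Fintype n]
    (M : Matrix m n ℝ) {v : ℝ → n → ℝ} (hv : Differentiable ℝ v)
    (h : ∀ t, M *ᵥ deriv v t = 0) (s t : ℝ) : M *ᵥ v s = M *ᵥ v t := by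
  have hd (x : ℝ) : HasDerivAt (fun t => M *ᵥ v t) 0 x := by
    have := (M.mulVecLin.toContinuousLinearMap).hasFDerivAt.comp_hasDerivAt x (hv x).hasDerivAt
    simpa [Function.comp_def, h x] using this
  exact is_const_of_deriv_eq_zero (fun x => (hd x).differentiableAt) (fun x => (hd x).deriv) s t

/-- Invariance of the divergence-free constraint under the projected ODE: if
`E v̇(t) = Πᵀ w(t)` for all `t`, with `Πᵀ = I - A12 S⁻¹ A12ᵀ E⁻¹`, and if
`A12ᵀ v(0) = 0`, then `A12ᵀ v(t) = 0` for all `t`. -/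
theorem divergence_free_invariant
    (nv np : ℕ) (hnv : 0 < nv) (hnp : 0 < np)
    (E : Matrix (Fin nv) (Fin nv) ℝ) (A12 : Matrix (Fin nv) (Fin np) ℝ)
    (hE : IsUnit E) (hS : IsUnit (A12ᵀ * E⁻¹ * A12))
    (v : ℝ → Fin nv → ℝ) (w : ℝ → Fin nv → ℝ)
    (hv : Differentiable ℝ v)
    (hode : ∀ t : ℝ, E.mulVec (deriv v t) =
        ((1 : Matrix (Fin nv) (Fin nv) ℝ)
            - A12 * (A12ᵀ * E⁻¹ * A12)⁻¹ * A12ᵀ * E⁻¹).mulVec (w t))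
    (h0 : A12ᵀ.mulVec (v 0) = 0) :
    ∀ t : ℝ, A12ᵀ.mulVec (v t) = 0 := by
  intro t
  rw [mulVec_eq_of_mulVec_deriv_eq_zero A12ᵀ hv (fun x => ?_) t 0, h0]
  have hE' := Matrix.nonsing_inv_mul _ ((Matrix.isUnit_iff_isUnit_det _).1 hE)
  calc A12ᵀ *ᵥ deriv v x = (A12ᵀ * E⁻¹) *ᵥ (E *ᵥ deriv v x) := by
        rw [Matrix.mulVec_mulVec, Matrix.mul_assoc, hE', Matrix.mul_one]
    _ = 0 := by
        rw [hode, Matrix.mulVec_mulVec, transpose_mul_inv_mul_lerayProjector E A12 hS,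
          Matrix.zero_mulVec]
end
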